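/- arXiv:1407.0682 — 5 statements merged into one kernel-verified Lean document; each statement's English description precedes it below -/
import Mathlib

section
/- Let h ≥ 2 be an integer and let A be an infinite set of nonnegative integers. If r_{A,h}(n) ≥ 2 for all sufficiently large integers n in the sumset hA, then there is a positive real number w₀ such that A(x) > (log x)/(log h) − w₀ for all real x ≥ h. -/
/-- The representation function `r_{A,h}(n)`: the number of nondecreasing
`h`-tuples `(a₁,…,a_h)` of elements of `A` with `a₁ + ⋯ + a_h = n`. -/
noncomputable def rep (A : Set ℕ) (h n : ℕ) : ℕ :=
  Set.ncard {f : Fin h → ℕ | (∀ i, f i ∈ A) ∧ Monotone f ∧ ∑ i, f i = n}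

/-- The `h`-fold sumset `hA`: all sums of `h` not necessarily distinct elements of `A`. -/
def sumset (A : Set ℕ) (h : ℕ) : Set ℕ :=
  {n | ∃ f : Fin h → ℕ, (∀ i, f i ∈ A) ∧ ∑ i, f i = n}

/-- The counting function `A(x)`: the number of `a ∈ A` with `1 ≤ a ≤ x`. -/
noncomputable def count (A : Set ℕ) (x : ℝ) : ℕ :=
  Set.ncard {a : ℕ | a ∈ A ∧ 1 ≤ a ∧ (a : ℝ) ≤ x}

/-- If `h * a` has a second representation as a sum of `h` elements of `A`, then `A` meets
`(a, h * a]`. -/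
theorem exists_mem_gt_le_mul {A : Set ℕ} {h a : ℕ} (hrep : 2 ≤ rep A h (h * a)) :
    ∃ b ∈ A, a < b ∧ b ≤ h * a := by
  obtain ⟨f, ⟨hfA, -, hfs⟩, hne⟩ :=
    Set.exists_ne_of_one_lt_ncard (show 1 < Set.ncard _ from hrep) (fun _ => a)
  have hgt : ∃ i, a < f i := by
    by_contra! hle
    have heq : ∑ i, f i = ∑ _i : Fin h, a := by simpa using hfs
    exact hne (funext fun i =>
      (Finset.sum_eq_sum_iff_of_le fun i _ => hle i).1 heq i (Finset.mem_univ i))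
  obtain ⟨i, hi⟩ := hgt
  exact ⟨f i, hfA i, hi,
    hfs ▸ Finset.single_le_sum (fun j _ => Nat.zero_le (f j)) (Finset.mem_univ i)⟩

theorem finite_count_set (A : Set ℕ) (x : ℝ) :
    {a : ℕ | a ∈ A ∧ 1 ≤ a ∧ (a : ℝ) ≤ x}.Finite :=
  (Set.finite_Iic ⌊x⌋₊).subset fun _ ha => Nat.le_floor ha.2.2

theorem count_mono (A : Set ℕ) : Monotone (count A) := fun _ y hxy =>
  Set.ncard_le_ncard (fun _ ha => ⟨ha.1, ha.2.1, ha.2.2.trans hxy⟩) (finite_count_set A y)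

theorem count_lt_count {A : Set ℕ} {x y : ℝ} {b : ℕ} (hb : b ∈ A) (hb₁ : 1 ≤ b)
    (hxb : x < b) (hby : b ≤ y) : count A x < count A y :=
  Set.ncard_lt_ncard
    ⟨fun _ ha => ⟨ha.1, ha.2.1, ha.2.2.trans (hxb.le.trans hby)⟩,
      fun hsub => hxb.not_ge (hsub ⟨hb, hb₁, hby⟩).2.2⟩
    (finite_count_set A y)

/-- If from `c ∈ A` on, the next element of `A` is at most `h` times the current one, then `A`
has at least `k + 1` positive elements up to `c * h ^ k`. -/
theorem lt_count_mul_pow {A : Set ℕ} {h c : ℕ} (hc : c ∈ A) (hc₁ : 1 ≤ c)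
    (hnext : ∀ a ∈ A, c ≤ a → ∃ b ∈ A, a < b ∧ b ≤ h * a) (k : ℕ) :
    k < count A ((c * h ^ k : ℕ) : ℝ) := by
  have key : ∃ b ∈ A, c ≤ b ∧ b ≤ c * h ^ k ∧ k < count A b := by
    induction k with
    | zero =>
      refine ⟨c, hc, le_rfl, by simp, (Nat.zero_le (count A 0)).trans_lt ?_⟩
      exact count_lt_count hc hc₁ (by exact_mod_cast hc₁) le_rfl
    | succ k ih =>
      obtain ⟨a, ha, hca, hak, hcount⟩ := ih
      obtain ⟨b, hb, hab, hbh⟩ := hnext a ha hca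
      refine ⟨b, hb, hca.trans hab.le, ?_, ?_⟩
      · calc b ≤ h * a := hbh
          _ ≤ h * (c * h ^ k) := Nat.mul_le_mul_left h hak
          _ = c * h ^ (k + 1) := by ring
      · have := count_lt_count hb (by omega) (Nat.cast_lt (α := ℝ).2 hab) le_rfl
        omega
  obtain ⟨b, -, -, hbk, hcount⟩ := key
  exact hcount.trans_le (count_mono A (Nat.cast_le.2 hbk))

theorem stmt_0 (h : ℕ) (hh : 2 ≤ h) (A : Set ℕ) (hA : A.Infinite)
    (hr : ∃ n₀ : ℕ, ∀ n : ℕ, n₀ ≤ n → n ∈ sumset A h → 2 ≤ rep A h n) :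
    ∃ w₀ : ℝ, 0 < w₀ ∧ ∀ x : ℝ, (h : ℝ) ≤ x →
      (count A x : ℝ) > Real.log x / Real.log h - w₀ := by
  obtain ⟨n₀, hn₀⟩ := hr
  obtain ⟨c, hc, hc₀⟩ := hA.exists_gt n₀
  have hc₁ : 1 ≤ c := by omega
  have hnext : ∀ a ∈ A, c ≤ a → ∃ b ∈ A, a < b ∧ b ≤ h * a := fun a ha hca =>
    exists_mem_gt_le_mul (hn₀ _ (by nlinarith) ⟨fun _ => a, fun _ => ha, by simp⟩)
  have hh' : (1 : ℝ) < h := by exact_mod_cast hh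
  have hlogh : 0 < Real.log h := Real.log_pos hh'
  have hc' : (1 : ℝ) ≤ c := by exact_mod_cast hc₁
  refine ⟨Real.log c / Real.log h + 1,
    by have := div_nonneg (Real.log_nonneg hc') hlogh.le; linarith, fun x hx => ?_⟩
  have hx₀ : 0 < x := by linarith
  rcases lt_or_ge x c with hxc | hcx
  · have hlt : Real.log x / Real.log h < Real.log c / Real.log h := by gcongr
    have := Nat.cast_nonneg (α := ℝ) (count A x)
    linarith
  · set t := Real.log x / Real.log h - Real.log c / Real.log h with ht
    have ht₀ : 0 ≤ t := sub_nonneg.2 (by gcongr)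
    have hpow : ((c * h ^ ⌊t⌋₊ : ℕ) : ℝ) ≤ x := by
      push_cast
      rw [← Real.log_le_log_iff (by positivity) hx₀, Real.log_mul (by positivity) (by positivity),
        Real.log_pow]
      have hmul : t * Real.log h = Real.log x - Real.log c := by rw [ht]; field_simp
      nlinarith [Nat.floor_le ht₀]
    have hcount : (⌊t⌋₊ : ℝ) < count A x :=
      Nat.cast_lt.2 ((lt_count_mul_pow hc hc₁ hnext _).trans_le (count_mono A hpow))
    have := Nat.lt_floor_add_one t
    linarith
end

section
/- Let h ≥ 2, ℓ ≥ 2, and s ≥ 1 be integers, let A be a B_{h−1,s}-set of nonnegative integers, and let a ∈ A. If r_{A,h}(h·a) ≥ ℓ, then the set {b ∈ A : a < b ≤ h·a} has cardinality at least (ℓ − 1)/s. -/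
/-- Only finitely many monotone tuples of natural numbers from `A` have a given sum. -/
theorem finite_monotone_tuples (A : Set ℕ) (k n : ℕ) :
    {f : Fin k → ℕ | (∀ i, f i ∈ A) ∧ Monotone f ∧ ∑ i, f i = n}.Finite := by
  refine (Set.finite_Iic (fun _ : Fin k => n)).subset ?_
  rintro f ⟨-, -, hf⟩ i
  exact hf ▸ Finset.single_le_sum (f := f) (fun _ _ => Nat.zero_le _) (Finset.mem_univ i)

/-- A monotone tuple with mean `a` that is not constantly `a` has last entry exceeding `a`. -/
theorem lt_last_of_ne_const {k a : ℕ} {f : Fin (k + 1) → ℕ} (hf : Monotone f)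
    (hsum : ∑ i, f i = (k + 1) * a) (hne : f ≠ fun _ => a) : a < f (Fin.last k) := by
  by_contra! hle
  have hi : ∀ i ∈ Finset.univ, f i ≤ a := fun i _ => (hf (Fin.le_last i)).trans hle
  have heq : ∑ i, f i = ∑ _i : Fin (k + 1), a := by simp [hsum]
  exact hne (funext fun i => (Finset.sum_eq_sum_iff_of_le hi).1 heq i (Finset.mem_univ i))

/-- The monotone `(k + 1)`-tuples with sum `n` and last entry `b` are at most as many as the
monotone `k`-tuples whose sum is `n - b`. -/
theorem ncard_last_eq_le (A : Set ℕ) (k n b s : ℕ)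
    (hB : ∀ m ∈ sumset A k, rep A k m ≤ s) :
    {f : Fin (k + 1) → ℕ | ((∀ i, f i ∈ A) ∧ Monotone f ∧ ∑ i, f i = n) ∧
      f (Fin.last k) = b}.ncard ≤ s := by
  rcases Set.eq_empty_or_nonempty {f : Fin (k + 1) → ℕ |
      ((∀ i, f i ∈ A) ∧ Monotone f ∧ ∑ i, f i = n) ∧ f (Fin.last k) = b} with hE | ⟨g, hg⟩
  · simp [hE]
  have hinit : ∀ f : Fin (k + 1) → ℕ, ∑ i, f i = n → f (Fin.last k) = b →
      ∑ i, Fin.init f i = n - b := by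
    intro f hf hb
    rw [Fin.sum_univ_castSucc, hb] at hf
    simp only [Fin.init]
    omega
  refine le_trans ?_ (hB (n - b) ⟨Fin.init g, fun i => hg.1.1 _, hinit g hg.1.2.2 hg.2⟩)
  refine Set.ncard_le_ncard_of_injOn Fin.init ?_ ?_ (finite_monotone_tuples A k (n - b))
  · rintro f ⟨⟨hA, hm, hf⟩, hb⟩
    exact ⟨fun i => hA _, fun i j hij => hm (Fin.castSucc_le_castSucc_iff.2 hij), hinit f hf hb⟩
  · rintro f ⟨-, hf⟩ f' ⟨-, hf'⟩ heq
    rw [← Fin.snoc_init_self f, ← Fin.snoc_init_self f', heq, hf, hf']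

theorem stmt_5 (h ℓ s : ℕ) (hh : 2 ≤ h) (hℓ : 2 ≤ ℓ) (hs : 1 ≤ s)
    (A : Set ℕ) (hB : ∀ n ∈ sumset A (h - 1), rep A (h - 1) n ≤ s)
    (a : ℕ) (ha : a ∈ A) (hr : ℓ ≤ rep A h (h * a)) :
    ((ℓ : ℝ) - 1) / (s : ℝ) ≤ ({b ∈ A | a < b ∧ b ≤ h * a}.ncard : ℝ) := by
  classical
  obtain ⟨k, rfl⟩ : ∃ k, h = k + 1 := ⟨h - 1, by omega⟩
  rw [Nat.add_sub_cancel] at hB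
  have hfin := finite_monotone_tuples A (k + 1) ((k + 1) * a)
  have hT : {b ∈ A | a < b ∧ b ≤ (k + 1) * a}.Finite :=
    (Set.finite_Iic ((k + 1) * a)).subset fun b hb => hb.2.2
  have hmaps : ∀ f ∈ hfin.toFinset.erase (fun _ => a), f (Fin.last k) ∈ hT.toFinset := by
    intro f hf
    obtain ⟨hne, hf⟩ := Finset.mem_erase.1 hf
    obtain ⟨hA, hm, hsum⟩ := hfin.mem_toFinset.1 hf
    refine hT.mem_toFinset.2 ⟨hA _, lt_last_of_ne_const hm hsum hne, ?_⟩
    exact hsum ▸ Finset.single_le_sum (f := f) (fun _ _ => Nat.zero_le _) (Finset.mem_univ _)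
  have hfiber : ∀ b ∈ hT.toFinset,
      ((hfin.toFinset.erase (fun _ => a)).filter fun f => f (Fin.last k) = b).card ≤ s := by
    intro b _
    refine le_trans ?_ (ncard_last_eq_le A k ((k + 1) * a) b s hB)
    rw [← Set.ncard_coe_finset]
    refine Set.ncard_le_ncard ?_ (hfin.subset fun f hf => hf.1)
    intro f hf
    obtain ⟨hf, hb⟩ := Finset.mem_filter.1 (Finset.mem_coe.1 hf)
    exact ⟨hfin.mem_toFinset.1 (Finset.mem_of_mem_erase hf), hb⟩
  have hcard := Finset.card_le_mul_card_image_of_maps_to hmaps s hfiber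
  have herase := Finset.pred_card_le_card_erase (s := hfin.toFinset) (a := fun _ => a)
  rw [rep, Set.ncard_eq_toFinset_card _ hfin] at hr
  rw [Set.ncard_eq_toFinset_card _ hT, div_le_iff₀ (by exact_mod_cast hs), sub_le_iff_le_add]
  have hle : ℓ ≤ hT.toFinset.card * s + 1 := by
    rw [mul_comm]
    omega
  exact_mod_cast hle
end

section
/- Let h ≥ 2 be an integer and let A be an infinite set of nonnegative integers such that r_{A,h}(n) ≥ 2 for all sufficiently large integers n in the sumset hA. Then there exists a positive integer k₀ such that for every integer k ≥ k₀, the set A ∩ [h^{k−1}, h^k) is nonempty. -/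
/-- If `a` bounds every element of `A` that is at most `h * a`, then `h * a` has at most one
representation, namely `a + ⋯ + a`. -/
theorem rep_mul_le_one {A : Set ℕ} {h a : ℕ} (ha : ∀ x ∈ A, x ≤ h * a → x ≤ a) :
    rep A h (h * a) ≤ 1 := by
  rw [← Set.ncard_singleton (fun _ : Fin h => a)]
  refine Set.ncard_le_ncard ?_ (Set.finite_singleton _)
  rintro f ⟨hfA, -, hsum⟩
  have hle : ∀ i ∈ Finset.univ, f i ≤ a := fun i hi =>
    ha _ (hfA i) (hsum ▸ Finset.single_le_sum (fun j _ => Nat.zero_le (f j)) hi)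
  have heq := (Finset.sum_eq_sum_iff_of_le hle).mp (by simp [hsum])
  exact funext fun i => heq i (Finset.mem_univ i)

theorem stmt_6 (h : ℕ) (hh : 2 ≤ h) (A : Set ℕ) (hA : A.Infinite)
    (hr : ∃ n₀ : ℕ, ∀ n : ℕ, n₀ ≤ n → n ∈ sumset A h → 2 ≤ rep A h n) :
    ∃ k₀ : ℕ, 0 < k₀ ∧ ∀ k : ℕ, k₀ ≤ k →
      (A ∩ Set.Ico (h ^ (k - 1)) (h ^ k)).Nonempty := by
  obtain ⟨n₀, hn₀⟩ := hr
  obtain ⟨b, hbA, hb⟩ := hA.exists_gt n₀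
  refine ⟨b + 1, b.succ_pos, fun k hk => ?_⟩
  by_contra hempty
  have hbk : b < h ^ (k - 1) := (Nat.le_sub_one_of_lt hk).trans_lt (Nat.lt_pow_self hh)
  obtain ⟨a, ⟨haA, hak⟩, hmax⟩ := Set.exists_max_image (A ∩ Set.Iio (h ^ (k - 1))) id
    ((Set.finite_Iio _).subset Set.inter_subset_right) ⟨b, hbA, hbk⟩
  have hba : b ≤ a := hmax b ⟨hbA, hbk⟩
  have hlt : h * a < h ^ k := by
    rw [← mul_pow_sub_one (by lia : k ≠ 0) h]
    exact Nat.mul_lt_mul_of_pos_left hak (by lia)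
  have hone : rep A h (h * a) ≤ 1 := rep_mul_le_one fun x hxA hx =>
    hmax x ⟨hxA, not_le.mp fun hkx => hempty ⟨x, hxA, hkx, hx.trans_lt hlt⟩⟩
  have hna : n₀ ≤ h * a := by nlinarith
  have htwo := hn₀ (h * a) hna ⟨fun _ => a, fun _ => haA, by simp⟩
  lia
end

section
/- Let ℓ ≥ 2 be an integer and let A be an infinite set of nonnegative integers such that r_{A,2}(n) ≥ ℓ for all sufficiently large integers n in the sumset 2A. Then there exists a positive integer k₀ such that for every integer k ≥ k₀ + 1, the set A ∩ [2^{k−1}, 2^k) has cardinality at least ℓ − 1. -/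
/-- If `a` is the largest element of `A` below `M`, then every representation of `2 * a` other
than `a + a` has its larger summand in `[M, 2 * M)`. -/
theorem rep_two_mul_le (A : Set ℕ) (a M : ℕ) (haM : a < M)
    (hmax : ∀ b ∈ A, b < M → b ≤ a) :
    rep A 2 (2 * a) ≤ (A ∩ Set.Ico M (2 * M)).ncard + 1 := by
  have hfin : (A ∩ Set.Ico M (2 * M)).Finite := (Set.finite_Ico _ _).subset Set.inter_subset_right
  refine le_trans ?_ (Set.ncard_insert_le a _)
  refine Set.ncard_le_ncard_of_injOn (fun f => f 1) ?_ ?_ (hfin.insert a)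
  · rintro f ⟨hfA, hmono, hsum⟩
    have h01 : f 0 ≤ f 1 := hmono (Fin.zero_le 1)
    rw [Fin.sum_univ_two] at hsum
    have hmax1 := hmax (f 1) (hfA 1)
    simp only [Set.mem_insert_iff, Set.mem_inter_iff, Set.mem_Ico]
    by_cases h : f 1 = a
    · exact Or.inl h
    · exact Or.inr ⟨hfA 1, by by_contra hlt; have := hmax1 (by omega); omega, by omega⟩
  · rintro f ⟨-, -, hf⟩ g ⟨-, -, hg⟩ hfg
    rw [Fin.sum_univ_two] at hf hg
    have hfg : f 1 = g 1 := hfg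
    ext i
    fin_cases i
    · change f 0 = g 0
      omega
    · exact hfg

theorem stmt_7 (ℓ : ℕ) (hℓ : 2 ≤ ℓ) (A : Set ℕ) (hA : A.Infinite)
    (hr : ∃ n₀ : ℕ, ∀ n : ℕ, n₀ ≤ n → n ∈ sumset A 2 → ℓ ≤ rep A 2 n) :
    ∃ k₀ : ℕ, 0 < k₀ ∧ ∀ k : ℕ, k₀ + 1 ≤ k →
      ℓ - 1 ≤ (A ∩ Set.Ico (2 ^ (k - 1)) (2 ^ k)).ncard := by
  obtain ⟨n₀, hr⟩ := hr
  obtain ⟨a₀, ha₀, hn₀⟩ := hA.exists_gt n₀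
  refine ⟨a₀, by omega, fun k hk => ?_⟩
  have ha₀M : a₀ < 2 ^ (k - 1) :=
    Nat.lt_two_pow_self.trans_le (Nat.pow_le_pow_right two_pos (by omega))
  have hpow : 2 ^ k = 2 * 2 ^ (k - 1) := by
    rw [← pow_succ', Nat.sub_add_cancel (by omega)]
  obtain ⟨a, ⟨haA, haM⟩, hmax⟩ := Set.exists_max_image (A ∩ Set.Iio (2 ^ (k - 1))) id
    ((Set.finite_Iio _).subset Set.inter_subset_right) ⟨a₀, ha₀, ha₀M⟩
  have ha₀a : a₀ ≤ a := hmax a₀ ⟨ha₀, ha₀M⟩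
  have hrep := hr (2 * a) (by omega) ⟨fun _ => a, fun _ => haA, by simp⟩
  have hle := rep_two_mul_le A a (2 ^ (k - 1)) haM fun b hb hbM => hmax b ⟨hb, hbM⟩
  rw [hpow]
  omega
end

section
/- Let h ≥ 2, ℓ ≥ 2, and s ≥ 1 be integers, and let A be an infinite B_{h−1,s}-set of nonnegative integers such that r_{A,h}(n) ≥ ℓ for all sufficiently large integers n in the sumset hA. Then there exists a positive integer k₀ such that for every integer k ≥ k₀ + 1, the set A ∩ [h^{k−1}, h^k) has cardinality at least (ℓ − 1)/s. -/
/-- Monotone tuples of elements of `A` with a prescribed sum form a finite set. -/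
theorem finite_rep_set (A : Set ℕ) (h n : ℕ) :
    {f : Fin h → ℕ | (∀ i, f i ∈ A) ∧ Monotone f ∧ ∑ i, f i = n}.Finite := by
  refine (Set.finite_Icc (0 : Fin h → ℕ) (fun _ => n)).subset ?_
  rintro f ⟨-, -, hf⟩
  refine ⟨fun i => Nat.zero_le _, fun i => ?_⟩
  rw [← hf]
  exact Finset.single_le_sum (f := f) (fun _ _ => Nat.zero_le _) (Finset.mem_univ i)

/-- Outside the sumset the representation function vanishes, so a bound on the sumset holds
everywhere. -/
theorem rep_le_of_forall_mem_sumset {A : Set ℕ} {h s : ℕ}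
    (hB : ∀ n ∈ sumset A h, rep A h n ≤ s) (n : ℕ) : rep A h n ≤ s := by
  by_cases hn : n ∈ sumset A h
  · exact hB n hn
  · have hempty : {f : Fin h → ℕ | (∀ i, f i ∈ A) ∧ Monotone f ∧ ∑ i, f i = n} = ∅ := by
      ext f
      simp only [Set.mem_ofPred_eq, Set.mem_empty_iff_false, iff_false]
      exact fun hf => hn ⟨f, hf.1, hf.2.2⟩
    simp [rep, hempty]

/-- At most `rep A m (n - b)` monotone representations of `n` by `m + 1` terms have
largest term `b`. -/
theorem ncard_rep_last_eq_le (A : Set ℕ) (m n b : ℕ) :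
    {f : Fin (m + 1) → ℕ | ((∀ i, f i ∈ A) ∧ Monotone f ∧ ∑ i, f i = n) ∧
      f (Fin.last m) = b}.ncard ≤ rep A m (n - b) := by
  refine Set.ncard_le_ncard_of_injOn (fun f i => f i.castSucc) ?_ ?_ (finite_rep_set A m (n - b))
  · rintro f ⟨⟨hfA, hmono, hsum⟩, hlast⟩
    rw [Fin.sum_univ_castSucc, hlast] at hsum
    exact ⟨fun i => hfA _, fun i j hij => hmono (Fin.castSucc_le_castSucc_iff.2 hij),
      Nat.eq_sub_of_add_eq hsum⟩
  · rintro f ⟨-, hf⟩ g ⟨-, hg⟩ hfg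
    ext i
    refine Fin.lastCases ?_ (fun j => congrFun hfg j) i
    rw [hf, hg]

/-- A monotone tuple with average `a` is constant or has its last term in `(a, (m + 1) * a]`. -/
theorem eq_const_or_last_mem_Ioc {m a : ℕ} {f : Fin (m + 1) → ℕ} (hmono : Monotone f)
    (hsum : ∑ i, f i = (m + 1) * a) :
    f = (fun _ => a) ∨ f (Fin.last m) ∈ Set.Ioc a ((m + 1) * a) := by
  by_cases hlt : a < f (Fin.last m)
  · right
    refine ⟨hlt, ?_⟩
    rw [← hsum]
    exact Finset.single_le_sum (f := f) (fun _ _ => Nat.zero_le _) (Finset.mem_univ _)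
  · left
    have hle : ∀ i ∈ Finset.univ, f i ≤ a :=
      fun i _ => (hmono (Fin.le_last i)).trans (not_lt.1 hlt)
    have heq := (Finset.sum_eq_sum_iff_of_le hle).1 (by simp [hsum])
    exact funext fun i => heq i (Finset.mem_univ i)

/-- If sums of `m` elements of `A` have at most `s` representations, then the number of
representations of `(m + 1) * a` is controlled by the elements of `A` in `(a, (m + 1) * a]`. -/
theorem rep_mul_le {A : Set ℕ} {m s : ℕ} (hB : ∀ n, rep A m n ≤ s) (a : ℕ) :
    rep A (m + 1) ((m + 1) * a) ≤ s * (A ∩ Set.Ioc a ((m + 1) * a)).ncard + 1 := by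
  classical
  have hS := finite_rep_set A (m + 1) ((m + 1) * a)
  have hT : (A ∩ Set.Ioc a ((m + 1) * a)).Finite := (Set.finite_Ioc _ _).inter_of_right _
  have hcard : (hS.toFinset.erase fun _ => a).card ≤ s * hT.toFinset.card := by
    refine Finset.card_le_mul_card_image_of_maps_to (f := fun f => f (Fin.last m)) ?_ s ?_
    · intro f hf
      simp only [Finset.mem_erase, Set.Finite.mem_toFinset, Set.mem_ofPred_eq] at hf
      simp only [Set.Finite.mem_toFinset]
      exact ⟨hf.2.1 _, (eq_const_or_last_mem_Ioc hf.2.2.1 hf.2.2.2).resolve_left hf.1⟩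
    · intro b _
      rw [← Set.ncard_coe_finset]
      refine (Set.ncard_le_ncard ?_ (hS.subset fun f hf => hf.1)).trans
        ((ncard_rep_last_eq_le A m ((m + 1) * a) b).trans (hB _))
      intro f hf
      simp only [Finset.coe_filter, Finset.mem_erase, Set.Finite.mem_toFinset,
        Set.mem_ofPred_eq] at hf
      exact ⟨hf.1.2, hf.2⟩
  rw [← Set.ncard_eq_toFinset_card _ hT] at hcard
  rw [rep, Set.ncard_eq_toFinset_card _ hS]
  have := Finset.pred_card_le_card_erase (s := hS.toFinset) (a := fun _ => a)
  omega

theorem stmt_8 (h ℓ s : ℕ) (hh : 2 ≤ h) (hℓ : 2 ≤ ℓ) (hs : 1 ≤ s)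
    (A : Set ℕ) (hA : A.Infinite)
    (hB : ∀ n ∈ sumset A (h - 1), rep A (h - 1) n ≤ s)
    (hr : ∃ n₀ : ℕ, ∀ n : ℕ, n₀ ≤ n → n ∈ sumset A h → ℓ ≤ rep A h n) :
    ∃ k₀ : ℕ, 0 < k₀ ∧ ∀ k : ℕ, k₀ + 1 ≤ k →
      ((ℓ : ℝ) - 1) / (s : ℝ) ≤ ((A ∩ Set.Ico (h ^ (k - 1)) (h ^ k)).ncard : ℝ) := by
  obtain ⟨n₀, hr⟩ := hr
  obtain ⟨m, rfl⟩ : ∃ m, h = m + 1 := ⟨h - 1, by omega⟩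
  obtain ⟨b, hbA, hb⟩ := hA.exists_gt n₀
  refine ⟨b + 1, b.succ_pos, fun k hk => ?_⟩
  obtain ⟨j, rfl⟩ : ∃ j, k = j + 1 := ⟨k - 1, by omega⟩
  rw [Nat.add_sub_cancel]
  have hbj : b < (m + 1) ^ j :=
    (show b < j by omega).trans (Nat.lt_pow_self (by omega))
  -- the largest element of `A` below `(m + 1) ^ j`
  obtain ⟨a, ⟨haA, haj⟩, hmax⟩ := Set.exists_max_image (A ∩ Set.Iio ((m + 1) ^ j)) id
    ((Set.finite_Iio _).inter_of_right _) ⟨b, hbA, hbj⟩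
  rw [Set.mem_Iio] at haj
  have hba : b ≤ a := hmax b ⟨hbA, hbj⟩
  have hrep : ℓ ≤ rep A (m + 1) ((m + 1) * a) :=
    hr _ (by nlinarith) ⟨fun _ => a, fun _ => haA, by simp⟩
  have hsub : A ∩ Set.Ioc a ((m + 1) * a) ⊆ A ∩ Set.Ico ((m + 1) ^ j) ((m + 1) ^ (j + 1)) := by
    rintro x ⟨hxA, hax, hxa⟩
    refine ⟨hxA, ?_, hxa.trans_lt ?_⟩
    · by_contra hx
      exact absurd (hmax x ⟨hxA, not_le.1 hx⟩) (not_le.2 hax)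
    · rw [pow_succ']
      exact Nat.mul_lt_mul_of_pos_left haj m.succ_pos
  have hncard := Set.ncard_le_ncard hsub ((Set.finite_Ico _ _).inter_of_right _)
  have hbound : ℓ ≤ s * (A ∩ Set.Ico ((m + 1) ^ j) ((m + 1) ^ (j + 1))).ncard + 1 :=
    hrep.trans ((rep_mul_le (rep_le_of_forall_mem_sumset hB) a).trans
      (Nat.add_le_add_right (Nat.mul_le_mul_left s hncard) 1))
  have hboundR : (ℓ : ℝ) ≤
      s * ((A ∩ Set.Ico ((m + 1) ^ j) ((m + 1) ^ (j + 1))).ncard : ℝ) + 1 := by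
    exact_mod_cast hbound
  rw [div_le_iff₀ (by exact_mod_cast hs)]
  linarith
end
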